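/- Let K be an imaginary quadratic number field and W a Schwartz class function. Then for all X > 0, n ∈ 𝓞_K \ {0} and r ∈ 𝓞_K, Σ_{m ∈ 𝓞_K, m ≡ r mod n} W(N(m)/X) = (X/N(n)) · Σ_{k ∈ 𝓞_K} W̃_K(√(N(k)X/N(n))) · ẽ_K(kr/n), where W̃_K(t) = ∬_{ℝ²} W(N(x + yω_K)) ẽ_K(−t(x + yω_K)) dx dy for t ≥ 0. -/

import Mathlib

open MeasureTheory

/-- The generator ω_K of the ring of integers: ω_K = (1+√d)/2 if d ≡ 1 (mod 4),
ω_K = √d otherwise, where √d = i√(-d). -/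
noncomputable def omegaK (d : ℤ) : ℂ :=
  if d % 4 = 1 then (1 + Complex.I * Real.sqrt (-(d : ℝ))) / 2
  else Complex.I * Real.sqrt (-(d : ℝ))

/-- The discriminant of K: D_K = d if d ≡ 1 (mod 4), D_K = 4d otherwise. -/
def DK (d : ℤ) : ℤ := if d % 4 = 1 then d else 4 * d

/-- A fixed square root of D_K (note D_K < 0): √D_K = i·√(-D_K). -/
noncomputable def sqrtDK (d : ℤ) : ℂ := Complex.I * Real.sqrt (-(DK d : ℝ))

/-- The additive character ẽ_K(z) = exp(2πi(z/√D_K - z̄/√D_K)). -/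
noncomputable def eK (d : ℤ) (z : ℂ) : ℂ :=
  Complex.exp (2 * (Real.pi : ℂ) * Complex.I *
    (z / sqrtDK d - (starRingEnd ℂ) z / sqrtDK d))

/-- The parametrization ℤ × ℤ → 𝓞_K = ℤ + ω_K ℤ ⊆ ℂ, (a, b) ↦ a + bω_K. -/
noncomputable def toC (d : ℤ) (p : ℤ × ℤ) : ℂ := (p.1 : ℂ) + (p.2 : ℂ) * omegaK d

/-- The transform W̃_K(t) = ∬_{ℝ²} W(N(x+yω_K)) ẽ_K(-t(x+yω_K)) dx dy. -/
noncomputable def WtildeK (d : ℤ) (W : SchwartzMap ℝ ℂ) (t : ℝ) : ℂ :=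
  ∫ p : ℝ × ℝ, W (Complex.normSq ((p.1 : ℂ) + (p.2 : ℂ) * omegaK d)) *
    eK d (-(t : ℂ) * ((p.1 : ℂ) + (p.2 : ℂ) * omegaK d))

open scoped FourierTransform

lemma summable_int_inv_one_add_sq : Summable fun n : ℤ => (1 + (n : ℝ) ^ 2)⁻¹ := by
  refine Summable.of_norm_bounded_eventually (Real.summable_one_div_int_pow.mpr one_lt_two) ?_
  rw [Filter.eventually_cofinite]
  refine (Set.finite_singleton (0 : ℤ)).subset fun n hn => ?_
  by_contra h
  refine hn ?_
  have : (0 : ℝ) < (n : ℝ) ^ 2 := by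
    have : (n : ℝ) ≠ 0 := by exact_mod_cast h
    positivity
  rw [Real.norm_of_nonneg (by positivity), one_div]
  gcongr
  linarith

/-- **Poisson summation** on `ℝ` under quadratic decay of the function. -/
lemma tsum_eq_tsum_fourier_of_inv_one_add_sq {f : ℝ → ℂ} (hc : Continuous f) {C : ℝ}
    (hf : ∀ x, ‖f x‖ ≤ C * (1 + x ^ 2)⁻¹) (hs : Summable fun n : ℤ => 𝓕 f n) :
    ∑' n : ℤ, f n = ∑' n : ℤ, 𝓕 f n := by
  have hO : f =O[Filter.cocompact ℝ] fun x : ℝ => |x| ^ (-2 : ℝ) := by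
    refine Asymptotics.IsBigO.of_bound C ?_
    filter_upwards [(Filter.hasBasis_cocompact.eventually_iff).mpr
      ⟨{0}, isCompact_singleton, fun x hx => hx⟩] with x hx
    have hx0 : x ≠ 0 := hx
    have hC : 0 ≤ C := by simpa using (norm_nonneg _).trans (hf 0)
    refine (hf x).trans ?_
    gcongr
    rw [Real.rpow_neg (abs_nonneg x), Real.rpow_two, sq_abs,
      Real.norm_of_nonneg (by positivity)]
    gcongr
    linarith
  simpa using Real.tsum_eq_tsum_fourier_of_rpow_decay_of_summable hc one_lt_two hO hs 0

/-- **Poisson summation** on `ℝ × ℝ` under quadratic decay in each variable. -/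
lemma tsum_prod_eq_tsum_fourier {F : ℝ × ℝ → ℂ} (hc : Continuous F) {C : ℝ}
    (hF : ∀ p : ℝ × ℝ, ‖F p‖ ≤ C * ((1 + p.1 ^ 2)⁻¹ * (1 + p.2 ^ 2)⁻¹))
    (hs : Summable fun k : ℤ × ℤ => ∫ p : ℝ × ℝ, 𝐞 (-(p.1 * k.1 + p.2 * k.2)) • F p) :
    ∑' k : ℤ × ℤ, F (k.1, k.2) =
      ∑' k : ℤ × ℤ, ∫ p : ℝ × ℝ, 𝐞 (-(p.1 * k.1 + p.2 * k.2)) • F p := by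
  have hC : 0 ≤ C := by simpa using (norm_nonneg _).trans (hF 0)
  have hle : ∀ x : ℝ, (1 + x ^ 2)⁻¹ ≤ 1 := fun x => inv_le_one_of_one_le₀ (by nlinarith)
  have hpos : ∀ x : ℝ, 0 ≤ (1 + x ^ 2)⁻¹ := fun x => by positivity
  have hint := integrable_inv_one_add_sq
  have hw := summable_int_inv_one_add_sq
  have hFi : Integrable F := by
    refine Integrable.mono' ((hint.mul_prod hint).const_mul C) hc.aestronglyMeasurable
      (.of_forall fun p => hF p)
  have hi1 : ∀ y, Integrable fun x => F (x, y) := fun y =>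
    Integrable.mono' ((hint.mul_const ((1 + y ^ 2)⁻¹)).const_mul C)
      (by fun_prop) (.of_forall fun x => hF (x, y))
  have hcirc : ∀ g : ℝ × ℝ → ℝ, Continuous g → Continuous fun p => 𝐞 (g p) • F p := fun g hg =>
    (Real.continuous_fourierChar.comp hg).smul hc
  -- the partial Fourier transform in the first variable
  set h : ℝ → ℝ → ℂ := fun k y => 𝓕 (fun x => F (x, y)) k with hh
  have h_eq : ∀ k y, h k y = ∫ x, 𝐞 (-(x * k)) • F (x, y) := fun k y =>
    Real.fourier_real_eq _ _
  have h_cont : ∀ k, Continuous (h k) := by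
    intro k
    rw [show h k = fun y => ∫ x, 𝐞 (-(x * k)) • F (x, y) from funext (h_eq k)]
    refine continuous_of_dominated (bound := fun x => C * (1 + x ^ 2)⁻¹) (fun y => ?_)
      (fun y => .of_forall fun x => ?_) (hint.const_mul C) (.of_forall fun x => ?_)
    · exact ((Real.continuous_fourierChar.comp (by fun_prop)).smul
        (hc.comp (by fun_prop))).aestronglyMeasurable
    · rw [Circle.norm_smul]
      refine (hF (x, y)).trans ?_
      gcongr
      exact mul_le_of_le_one_right (hpos x) (hle y)
    · exact continuous_const.smul (hc.comp (by fun_prop))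
  have h_bound : ∀ k y, ‖h k y‖ ≤ C * (∫ x : ℝ, (1 + x ^ 2)⁻¹) * (1 + y ^ 2)⁻¹ := by
    intro k y
    rw [h_eq, ← integral_const_mul, ← integral_mul_const]
    refine norm_integral_le_of_norm_le ((hint.const_mul C).mul_const _)
      (.of_forall fun x => ?_)
    rw [Circle.norm_smul, mul_assoc]
    exact hF (x, y)
  have h_four : ∀ k l : ℝ, 𝓕 (h k) l =
      ∫ p : ℝ × ℝ, 𝐞 (-(p.1 * k + p.2 * l)) • F p := by
    intro k l
    have hi : Integrable fun p : ℝ × ℝ => 𝐞 (-(p.1 * k + p.2 * l)) • F p := by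
      refine hFi.norm.mono' (hcirc _ (by fun_prop)).aestronglyMeasurable
        (.of_forall fun p => ?_)
      rw [Circle.norm_smul]
    rw [Real.fourier_real_eq, Measure.volume_eq_prod, integral_prod_symm _ hi]
    refine integral_congr_ae (.of_forall fun y => ?_)
    simp only [h_eq]
    rw [Circle.smul_def, ← integral_smul]
    refine integral_congr_ae (.of_forall fun x => ?_)
    simp only [← Circle.smul_def, smul_smul, ← AddChar.map_add_eq_mul]
    congr 2
    ring
  have h_tsum : ∀ k : ℤ, ∑' b : ℤ, h k b =
      ∑' l : ℤ, ∫ p : ℝ × ℝ, 𝐞 (-(p.1 * k + p.2 * l)) • F p := by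
    intro k
    have := tsum_eq_tsum_fourier_of_inv_one_add_sq (h_cont k) (h_bound k)
      (by simpa only [h_four] using hs.prod_factor k)
    simpa only [h_four] using this
  -- the sum over the second variable
  set G : ℝ → ℂ := fun x => ∑' b : ℤ, F (x, b) with hG
  have hFsum : ∀ x, Summable fun b : ℤ => F (x, b) := fun x =>
    .of_norm_bounded ((hw.mul_left ((1 + x ^ 2)⁻¹)).mul_left C) fun b => hF (x, b)
  have G_cont : Continuous G := by
    refine continuous_tsum (u := fun b : ℤ => C * (1 + (b : ℝ) ^ 2)⁻¹)
      (fun b => hc.comp (by fun_prop)) (hw.mul_left C) fun b x => (hF (x, b)).trans ?_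
    gcongr
    exact mul_le_of_le_one_left (hpos _) (hle x)
  have G_bound : ∀ x, ‖G x‖ ≤ C * (∑' b : ℤ, (1 + (b : ℝ) ^ 2)⁻¹) * (1 + x ^ 2)⁻¹ := by
    intro x
    rw [mul_assoc, mul_comm (∑' b : ℤ, _), ← tsum_mul_left, ← tsum_mul_left]
    exact tsum_of_norm_bounded ((hw.mul_left ((1 + x ^ 2)⁻¹)).mul_left C).hasSum fun b => hF (x, b)
  have G_four : ∀ k : ℤ, 𝓕 G k = ∑' l : ℤ, ∫ p : ℝ × ℝ, 𝐞 (-(p.1 * k + p.2 * l)) • F p := by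
    intro k
    rw [← h_tsum, Real.fourier_real_eq]
    simp only [h_eq]
    rw [integral_tsum_of_summable_integral_norm]
    · refine integral_congr_ae (.of_forall fun x => ?_)
      simp only [hG, Circle.smul_def]
      exact ((hFsum x).tsum_const_smul _).symm
    · intro b
      refine (hi1 b).norm.mono' ((Real.continuous_fourierChar.comp (by fun_prop)).smul
        (hc.comp (by fun_prop))).aestronglyMeasurable (.of_forall fun x => ?_)
      rw [Circle.norm_smul]
    · refine Summable.of_nonneg_of_le (fun b => integral_nonneg fun x => norm_nonneg _)
        (fun b => ?_) (hw.mul_left (C * (∫ x : ℝ, (1 + x ^ 2)⁻¹)))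
      rw [← integral_const_mul, ← integral_mul_const]
      refine integral_mono_of_nonneg (.of_forall fun x => norm_nonneg _)
        ((hint.const_mul C).mul_const _) (.of_forall fun x => ?_)
      simp only [Circle.norm_smul, mul_assoc]
      exact hF (x, b)
  have hFsum2 : Summable fun k : ℤ × ℤ => F (k.1, k.2) := by
    refine .of_norm_bounded (g := fun k : ℤ × ℤ =>
      C * ((1 + (k.1 : ℝ) ^ 2)⁻¹ * (1 + (k.2 : ℝ) ^ 2)⁻¹)) ?_ fun k => hF _
    exact (hw.mul_of_nonneg hw (fun _ => hpos _) fun _ => hpos _).mul_left C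
  rw [hFsum2.tsum_prod, hs.tsum_prod]
  have := tsum_eq_tsum_fourier_of_inv_one_add_sq G_cont G_bound
    (by simpa only [G_four] using hs.prod)
  simpa only [G_four] using this

lemma SchwartzMap.exists_norm_le_inv_one_add_sq (ψ : SchwartzMap ℂ ℂ) (C : ℝ) :
    ∃ C', ∀ (p : ℝ × ℝ) (z : ℂ), ‖p‖ ≤ C * (1 + ‖z‖) →
      ‖ψ z‖ ≤ C' * ((1 + p.1 ^ 2)⁻¹ * (1 + p.2 ^ 2)⁻¹) := by
  obtain ⟨M, hM⟩ : ∃ M, ∀ z, (1 + ‖z‖) ^ 4 * ‖ψ z‖ ≤ M := ⟨_, fun z => by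
    simpa using SchwartzMap.one_add_le_sup_seminorm_apply (𝕜 := ℝ) (m := (4, 0)) le_rfl le_rfl ψ z⟩
  refine ⟨M * (1 + C ^ 2) ^ 2, fun p z h => ?_⟩
  have key : ∀ x : ℝ, |x| ≤ ‖p‖ → 1 + x ^ 2 ≤ (1 + C ^ 2) * (1 + ‖z‖) ^ 2 := by
    intro x hx
    have h1 : x ^ 2 ≤ (C * (1 + ‖z‖)) ^ 2 := by
      rw [← sq_abs]
      exact pow_le_pow_left₀ (abs_nonneg x) (hx.trans h) 2
    nlinarith [norm_nonneg z, sq_nonneg ‖z‖]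
  have h1 := key p.1 (norm_fst_le p)
  have h2 := key p.2 (norm_snd_le p)
  have h3 : (1 + p.1 ^ 2) * (1 + p.2 ^ 2) ≤ (1 + C ^ 2) ^ 2 * (1 + ‖z‖) ^ 4 := by
    calc _ ≤ ((1 + C ^ 2) * (1 + ‖z‖) ^ 2) * ((1 + C ^ 2) * (1 + ‖z‖) ^ 2) := by gcongr
      _ = _ := by ring
  rw [← mul_inv, ← div_eq_mul_inv, le_div_iff₀ (by positivity)]
  calc ‖ψ z‖ * ((1 + p.1 ^ 2) * (1 + p.2 ^ 2))
      ≤ ‖ψ z‖ * ((1 + C ^ 2) ^ 2 * (1 + ‖z‖) ^ 4) := by gcongr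
    _ = ((1 + ‖z‖) ^ 4 * ‖ψ z‖) * (1 + C ^ 2) ^ 2 := by ring
    _ ≤ _ := by gcongr; exact hM z

/-- A Schwartz function of the norm `N(z) = |z|²` is a Schwartz function on `ℂ`. -/
lemma SchwartzMap.exists_eq_comp_normSq (W : SchwartzMap ℝ ℂ) :
    ∃ φ : SchwartzMap ℂ ℂ, ∀ z, φ z = W (Complex.normSq z) := by
  refine ⟨SchwartzMap.compCLM (g := fun z : ℂ => ‖z‖ ^ 2) ℝ
    (Function.hasTemperateGrowth_norm_sq ℂ) ⟨1, 1, fun z => ?_⟩ W, fun z => ?_⟩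
  · rw [Real.norm_of_nonneg (by positivity)]
    nlinarith [sq_nonneg (‖z‖ - 1)]
  · simp [Complex.normSq_eq_norm_sq]

/-- Affine change of variables in `ℂ`. -/
lemma Complex.integral_comp_mul_add (g : ℂ → ℂ) (α γ : ℂ) :
    ∫ z, g (α * (z + γ)) = ((Complex.normSq α)⁻¹ : ℝ) * ∫ z, g z := by
  rw [integral_add_right_eq_self (fun z => g (α * z)) γ]
  have hu : α = (‖α‖ : ℂ) * Circle.exp α.arg := by simp
  have h1 : ∫ z, g (α * z) = ∫ z, g (‖α‖ • rotation (Circle.exp α.arg) z) := by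
    congr 1 with z
    rw [rotation_apply, Complex.real_smul, ← mul_assoc, ← hu]
  rw [h1, (rotation (Circle.exp α.arg)).measurePreserving.integral_comp
    (rotation (Circle.exp α.arg)).toHomeomorph.measurableEmbedding (fun z => g (‖α‖ • z)),
    Measure.integral_comp_smul, Complex.finrank_real_complex, Complex.real_smul,
    Complex.normSq_eq_norm_sq, abs_of_nonneg (by positivity)]

section Lattice

variable {d : ℤ}

lemma omegaK_im_eq (d : ℤ) : (omegaK d).im = √(-(DK d : ℝ)) / 2 := by
  unfold omegaK DK
  split_ifs
  · simp
  · have : (-((4 * d : ℤ) : ℝ)) = 2 ^ 2 * (-(d : ℝ)) := by push_cast; ring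
    rw [this, Real.sqrt_mul (by norm_num), Real.sqrt_sq (by norm_num)]
    simp

lemma omegaK_im_pos (hd : d < 0) : 0 < (omegaK d).im := by
  rw [omegaK_im_eq]
  have : (DK d : ℝ) < 0 := by
    have : DK d < 0 := by unfold DK; split_ifs <;> omega
    exact_mod_cast this
  have := Real.sqrt_pos.mpr (neg_pos.mpr this)
  positivity

lemma exists_omegaK_sq_eq (hd : d < 0) : ∃ s t : ℤ, omegaK d ^ 2 = s * omegaK d + t := by
  have hsq : (√(-(d : ℝ)) : ℂ) ^ 2 = -d := by
    rw [← Complex.ofReal_pow, Real.sq_sqrt (by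
      have : (d : ℝ) < 0 := by exact_mod_cast hd
      linarith)]
    simp
  by_cases h : d % 4 = 1
  · refine ⟨1, (d - 1) / 4, ?_⟩
    have hq : (d : ℂ) = 4 * (((d - 1) / 4 : ℤ) : ℂ) + 1 := by
      have : d = 4 * ((d - 1) / 4) + 1 := by omega
      exact_mod_cast this
    simp only [omegaK, h, if_true]
    linear_combination (-1 / 4) * hsq + (1 / 4) * hq +
      (√(-(d : ℝ)) : ℂ) ^ 2 / 4 * Complex.I_sq
  · refine ⟨0, d, ?_⟩
    simp only [omegaK, h, if_false]
    rw [mul_pow, hsq]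
    simp

/-- The character `ẽ_K` only sees the `ω_K`-coordinate. -/
lemma eK_eq_fourierChar (hd : d < 0) (z : ℂ) : eK d z = 𝐞 (z.im / (omegaK d).im) := by
  have h0 : (√(-(DK d : ℝ)) : ℂ) ≠ 0 := by
    have := omegaK_im_pos hd
    rw [omegaK_im_eq] at this
    exact_mod_cast (by linarith : 0 < √(-(DK d : ℝ))).ne'
  rw [eK, Real.fourierChar_apply, omegaK_im_eq, sqrtDK, ← sub_div, Complex.sub_conj]
  congr 1
  push_cast
  field_simp

lemma eK_add (d : ℤ) (z w : ℂ) : eK d (z + w) = eK d z * eK d w := by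
  simp only [eK, ← Complex.exp_add, map_add]
  ring_nf

lemma norm_eK (hd : d < 0) (z : ℂ) : ‖eK d z‖ = 1 := by
  rw [eK_eq_fourierChar hd, Circle.norm_coe]

/-- The coordinates of `ℂ` with respect to the basis `1, ω_K`. -/
noncomputable def coordEquiv (d : ℤ) (hd : d < 0) : (ℝ × ℝ) ≃L[ℝ] ℂ :=
  LinearEquiv.toContinuousLinearEquiv
    { toFun := fun p => (p.1 : ℂ) + p.2 * omegaK d
      map_add' := fun p q => by simp; ring
      map_smul' := fun c p => by simp; ring
      invFun := fun z => (z.re - z.im / (omegaK d).im * (omegaK d).re, z.im / (omegaK d).im)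
      left_inv := fun p => by
        have := (omegaK_im_pos hd).ne'
        ext <;> simp [this]
      right_inv := fun z => by
        have := (omegaK_im_pos hd).ne'
        apply Complex.ext <;> simp [this] }

lemma coordEquiv_apply (hd : d < 0) (p : ℝ × ℝ) :
    coordEquiv d hd p = (p.1 : ℂ) + p.2 * omegaK d := rfl

lemma toC_eq_coordEquiv (hd : d < 0) (k : ℤ × ℤ) :
    toC d k = coordEquiv d hd ((k.1 : ℝ), (k.2 : ℝ)) := by
  simp [toC, coordEquiv_apply]

lemma toC_injective (hd : d < 0) : Function.Injective (toC d) := by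
  intro k l h
  rw [toC_eq_coordEquiv hd, toC_eq_coordEquiv hd] at h
  simpa [Prod.ext_iff] using (coordEquiv d hd).injective h

lemma exists_norm_le_mul_norm_coordEquiv (hd : d < 0) :
    ∃ C, 0 ≤ C ∧ ∀ p, ‖p‖ ≤ C * ‖coordEquiv d hd p‖ :=
  ⟨‖((coordEquiv d hd).symm : ℂ →L[ℝ] ℝ × ℝ)‖, norm_nonneg _, fun p => by
    simpa using ((coordEquiv d hd).symm : ℂ →L[ℝ] ℝ × ℝ).le_opNorm (coordEquiv d hd p)⟩

lemma exists_integral_comp_coordEquiv (hd : d < 0) :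
    ∃ c : ℝ, ∀ g : ℂ → ℂ, ∫ p, g (coordEquiv d hd p) = c * ∫ z, g z := by
  have := (coordEquiv d hd).isAddHaarMeasure_map (volume : Measure (ℝ × ℝ))
  obtain ⟨c, hc⟩ : ∃ c : NNReal, (volume : Measure (ℝ × ℝ)).map (coordEquiv d hd) = c • volume :=
    ⟨_, Measure.isAddLeftInvariant_eq_smul _ _⟩
  refine ⟨c, fun g => ?_⟩
  have hmap := (coordEquiv d hd).toHomeomorph.measurableEmbedding.integral_map (μ := volume) g
  simp only [ContinuousLinearEquiv.coe_toHomeomorph] at hmap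
  rw [← hmap, hc, integral_smul_nnreal_measure, NNReal.smul_def, Complex.real_smul]

/-- The pairing `(κ, z) ↦ ẽ_K(-κz)` in coordinates. -/
lemma eK_neg_toC_mul_coordEquiv (hd : d < 0) {s t : ℤ}
    (hst : omegaK d ^ 2 = s * omegaK d + t) (k : ℤ × ℤ) (p : ℝ × ℝ) :
    eK d (-(toC d k * coordEquiv d hd p)) =
      𝐞 (-(p.1 * k.2 + p.2 * ((k.1 + s * k.2 : ℤ) : ℝ))) := by
  have h0 := (omegaK_im_pos hd).ne'
  rw [eK_eq_fourierChar hd]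
  congr 2
  have : -(toC d k * coordEquiv d hd p) =
      ((-(p.1 * k.2 + p.2 * ((k.1 + s * k.2 : ℤ) : ℝ)) : ℝ) : ℂ) * omegaK d +
      ((-(k.1 * p.1 + k.2 * p.2 * t) : ℝ) : ℂ) := by
    rw [toC, coordEquiv_apply]
    push_cast
    linear_combination (-(k.2 : ℂ) * p.2) * hst
  rw [this, Complex.add_im, Complex.im_ofReal_mul, Complex.ofReal_im, add_zero,
    mul_div_cancel_right₀ _ h0]

/-- Rapid decay of the transform `W̃_K`. -/
lemma exists_norm_WtildeK_le (hd : d < 0) (W : SchwartzMap ℝ ℂ) {C : ℝ} (hC : 0 ≤ C) :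
    ∃ C', ∀ (p : ℝ × ℝ) (t : ℝ), ‖p‖ ≤ C * |t| →
      ‖WtildeK d W t‖ ≤ C' * ((1 + p.1 ^ 2)⁻¹ * (1 + p.2 ^ 2)⁻¹) := by
  obtain ⟨φ, hφ⟩ := W.exists_eq_comp_normSq
  obtain ⟨c, hc⟩ := exists_integral_comp_coordEquiv hd
  have him := omegaK_im_pos hd
  have hW : ∀ t : ℝ, WtildeK d W t = c * 𝓕 φ ((t / (omegaK d).im : ℝ) * Complex.I) := by
    intro t
    rw [SchwartzMap.fourier_coe, Real.fourier_eq, WtildeK]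
    simp only [← coordEquiv_apply hd]
    rw [hc (fun z => W (Complex.normSq z) * eK d (-(t : ℂ) * z))]
    congr 2 with z
    rw [eK_eq_fourierChar hd, Circle.smul_def, smul_eq_mul, mul_comm, hφ]
    congr 3
    rw [Complex.inner]
    simp
    ring
  obtain ⟨C', hC'⟩ := (𝓕 φ).exists_norm_le_inv_one_add_sq (C * (omegaK d).im)
  refine ⟨|c| * C', fun p t h => ?_⟩
  rw [hW, norm_mul, Complex.norm_real, Real.norm_eq_abs, mul_assoc]
  gcongr
  refine hC' p _ (h.trans ?_)
  rw [norm_mul, Complex.norm_I, mul_one, Complex.norm_real, Real.norm_eq_abs, abs_div,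
    abs_of_pos him, mul_assoc, mul_add, mul_div_cancel₀ _ him.ne']
  gcongr
  linarith

/-- The Fourier coefficients of `z ↦ W(N(r + nz)/X)` in terms of `W̃_K`. -/
lemma integral_comp_normSq_mul_eK (hd : d < 0) (W : SchwartzMap ℝ ℂ) {X : ℝ} (hX : 0 < X)
    {n : ℂ} (hn : n ≠ 0) (r κ : ℂ) :
    ∫ p : ℝ × ℝ, W (Complex.normSq (r + n * coordEquiv d hd p) / X) *
        eK d (-(κ * coordEquiv d hd p)) =
      ((X / Complex.normSq n : ℝ) : ℂ) *
        (WtildeK d W (√(Complex.normSq κ * X / Complex.normSq n)) * eK d (κ * r / n)) := by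
  obtain ⟨c, hc⟩ := exists_integral_comp_coordEquiv hd
  have hN : 0 < Complex.normSq n := Complex.normSq_pos.mpr hn
  set t : ℝ := √(Complex.normSq κ * X / Complex.normSq n) with ht
  have htsq : t ^ 2 = Complex.normSq κ * X / Complex.normSq n :=
    Real.sq_sqrt (by have := Complex.normSq_nonneg κ; positivity)
  obtain ⟨α, hα, hακ⟩ : ∃ α : ℂ, Complex.normSq α = Complex.normSq n / X ∧ (t : ℂ) * α = κ := by
    by_cases hκ : κ = 0
    · refine ⟨n / (√X : ℝ), ?_, by simp [ht, hκ]⟩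
      rw [Complex.normSq_div, Complex.normSq_ofReal, Real.mul_self_sqrt hX.le]
    · have hκ' : 0 < Complex.normSq κ := Complex.normSq_pos.mpr hκ
      have ht0 : t ≠ 0 := (Real.sqrt_pos.mpr (by positivity)).ne'
      refine ⟨κ / t, ?_, mul_div_cancel₀ _ (by exact_mod_cast ht0)⟩
      rw [Complex.normSq_div, Complex.normSq_ofReal, ← pow_two, htsq]
      field_simp
  have hW : WtildeK d W t = c * ∫ z, W (Complex.normSq z) * eK d (-(t : ℂ) * z) := by
    simp only [WtildeK, ← coordEquiv_apply hd]
    exact hc fun z => W (Complex.normSq z) * eK d (-(t : ℂ) * z)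
  have hpt : ∀ z : ℂ, W (Complex.normSq (r + n * z) / X) * eK d (-(κ * z)) =
      W (Complex.normSq (α * (z + r / n))) * eK d (-(t : ℂ) * (α * (z + r / n))) *
        eK d (κ * r / n) := by
    intro z
    have h1 : -(κ * z) = -(t : ℂ) * (α * (z + r / n)) + κ * r / n := by
      rw [← hακ]; ring
    have h2 : Complex.normSq (r + n * z) / X = Complex.normSq (α * (z + r / n)) := by
      rw [show r + n * z = n * (z + r / n) by field_simp; ring, map_mul, map_mul, hα]
      ring
    rw [h1, h2, eK_add, mul_assoc]
  rw [hc fun z => W (Complex.normSq (r + n * z) / X) * eK d (-(κ * z)), hW]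
  simp only [hpt]
  rw [integral_mul_const, Complex.integral_comp_mul_add
    (fun w => W (Complex.normSq w) * eK d (-(t : ℂ) * w)), hα, inv_div]
  ring

/-- `𝓞_K = ℤ + ω_K ℤ` is closed under `q ↦ r + nq` for `n, r ∈ 𝓞_K`. -/
lemma exists_toC_eq_add_mul (hd : d < 0) (n r q : ℤ × ℤ) :
    ∃ m : ℤ × ℤ, toC d m = toC d r + toC d n * toC d q := by
  obtain ⟨s, t, hst⟩ := exists_omegaK_sq_eq hd
  refine ⟨(r.1 + n.1 * q.1 + n.2 * q.2 * t,
    r.2 + n.1 * q.2 + n.2 * q.1 + n.2 * q.2 * s), ?_⟩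
  simp only [toC]
  push_cast
  linear_combination (-(n.2 : ℂ) * q.2) * hst

end Lattice

/-- Poisson summation for K: for a Schwartz function W, X > 0,
n ∈ 𝓞_K \ {0} and r ∈ 𝓞_K,
Σ_{m ∈ 𝓞_K, m ≡ r mod n} W(N(m)/X)
  = (X/N(n)) Σ_{k ∈ 𝓞_K} W̃_K(√(N(k)X/N(n))) ẽ_K(kr/n). -/
theorem poisson_summation_imaginary_quadratic (d : ℤ) (hd : d < 0) (hsq : Squarefree d)
    (W : SchwartzMap ℝ ℂ) (X : ℝ) (hX : 0 < X)
    (n r : ℂ) (hn : ∃ a b : ℤ, n = (a : ℂ) + (b : ℂ) * omegaK d) (hn0 : n ≠ 0)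
    (hr : ∃ a b : ℤ, r = (a : ℂ) + (b : ℂ) * omegaK d) :
    (∑' m : {p : ℤ × ℤ // ∃ a b : ℤ, toC d p - r = n * ((a : ℂ) + (b : ℂ) * omegaK d)},
        W (Complex.normSq (toC d m.1) / X))
    = ((X / Complex.normSq n : ℝ) : ℂ) *
        ∑' k : ℤ × ℤ,
          WtildeK d W (Real.sqrt (Complex.normSq (toC d k) * X / Complex.normSq n)) *
            eK d (toC d k * r / n) := by
  obtain ⟨s, t, hst⟩ := exists_omegaK_sq_eq hd
  obtain ⟨n₁, n₂, hn⟩ := hn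
  obtain ⟨r₁, r₂, hr⟩ := hr
  replace hn : n = toC d (n₁, n₂) := hn
  replace hr : r = toC d (r₁, r₂) := hr
  have hN : 0 < Complex.normSq n := Complex.normSq_pos.mpr hn0
  obtain ⟨C, hC, hCL⟩ := exists_norm_le_mul_norm_coordEquiv hd
  set F : ℝ × ℝ → ℂ := fun p => W (Complex.normSq (r + n * coordEquiv d hd p) / X) with hFdef
  have hFc : Continuous F := W.continuous.comp (by fun_prop)
  -- decay of `F`
  obtain ⟨C₁, hF⟩ : ∃ C₁, ∀ p : ℝ × ℝ,
      ‖F p‖ ≤ C₁ * ((1 + p.1 ^ 2)⁻¹ * (1 + p.2 ^ 2)⁻¹) := by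
    obtain ⟨φ, hφ⟩ := W.exists_eq_comp_normSq
    have hX' : 0 < √X := Real.sqrt_pos.mpr hX
    obtain ⟨C₁, hC₁⟩ := φ.exists_norm_le_inv_one_add_sq (C * ((√X + ‖r‖) / ‖n‖))
    refine ⟨C₁, fun p => ?_⟩
    set z : ℂ := (r + n * coordEquiv d hd p) / (√X : ℝ) with hz
    have hFz : F p = φ z := by
      rw [hφ, hz, Complex.normSq_div, Complex.normSq_ofReal, Real.mul_self_sqrt hX.le]
    rw [hFz]
    refine hC₁ p z ((hCL p).trans ?_)
    rw [mul_assoc]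
    gcongr
    have hn' : 0 < ‖n‖ := norm_pos_iff.mpr hn0
    have hnL : n * coordEquiv d hd p = (√X : ℝ) * z - r := by
      rw [hz, mul_div_cancel₀ _ (by exact_mod_cast hX'.ne')]
      ring
    rw [div_mul_eq_mul_div, le_div_iff₀ hn', mul_comm, ← norm_mul, hnL]
    refine (norm_sub_le _ _).trans ?_
    rw [norm_mul, Complex.norm_real, Real.norm_of_nonneg hX'.le]
    nlinarith [norm_nonneg z, norm_nonneg r, mul_nonneg (norm_nonneg z) (norm_nonneg r)]
  -- the Fourier coefficients of `F`, reindexed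
  let e : ℤ × ℤ ≃ ℤ × ℤ :=
    { toFun := fun k => (k.2, k.1 + s * k.2)
      invFun := fun k => (k.2 - s * k.1, k.1)
      left_inv := fun k => by simp
      right_inv := fun k => by simp }
  have hcoeff : ∀ k : ℤ × ℤ,
      ∫ p : ℝ × ℝ, 𝐞 (-(p.1 * (e k).1 + p.2 * (e k).2)) • F p =
        ((X / Complex.normSq n : ℝ) : ℂ) *
          (WtildeK d W (√(Complex.normSq (toC d k) * X / Complex.normSq n)) *
            eK d (toC d k * r / n)) := by
    intro k
    rw [← integral_comp_normSq_mul_eK hd W hX hn0]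
    congr 1 with p
    rw [eK_neg_toC_mul_coordEquiv hd hst, Circle.smul_def, smul_eq_mul, mul_comm]
    rfl
  have hsum : Summable fun k : ℤ × ℤ =>
      ∫ p : ℝ × ℝ, 𝐞 (-(p.1 * k.1 + p.2 * k.2)) • F p := by
    rw [← e.summable_iff]
    simp only [Function.comp_def, hcoeff]
    refine Summable.mul_left _ ?_
    have hq : 0 < √(X / Complex.normSq n) := Real.sqrt_pos.mpr (by positivity)
    obtain ⟨C₂, hC₂⟩ := exists_norm_WtildeK_le hd W
      (C := C / √(X / Complex.normSq n)) (by positivity)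
    refine .of_norm_bounded (g := fun k : ℤ × ℤ =>
      C₂ * ((1 + (k.1 : ℝ) ^ 2)⁻¹ * (1 + (k.2 : ℝ) ^ 2)⁻¹)) ?_ fun k => ?_
    · exact (summable_int_inv_one_add_sq.mul_of_nonneg summable_int_inv_one_add_sq
        (fun _ => by positivity) fun _ => by positivity).mul_left C₂
    · rw [norm_mul, norm_eK hd, mul_one]
      refine hC₂ ((k.1 : ℝ), (k.2 : ℝ)) _ ((hCL _).trans (le_of_eq ?_))
      rw [abs_of_nonneg (Real.sqrt_nonneg _), mul_div_assoc,
        Real.sqrt_mul (Complex.normSq_nonneg _), ← Complex.norm_def, toC_eq_coordEquiv hd]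
      field_simp
  -- the residue class of `r` modulo `n` is parametrized by `q ↦ r + nq`
  choose f hf using exists_toC_eq_add_mul hd (n₁, n₂) (r₁, r₂)
  simp only [← hn, ← hr] at hf
  let g : ℤ × ℤ → {p : ℤ × ℤ // ∃ a b : ℤ, toC d p - r = n * ((a : ℂ) + (b : ℂ) * omegaK d)} :=
    fun q => ⟨f q, q.1, q.2, by rw [hf, toC]; ring⟩
  have hg : Function.Bijective g := by
    refine ⟨fun q q' h => ?_, fun m => ?_⟩
    · have h' : f q = f q' := congrArg Subtype.val h
      refine toC_injective hd (mul_left_cancel₀ hn0 (add_left_cancel (a := r) ?_))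
      rw [← hf, ← hf, h']
    · obtain ⟨m, a, b, h⟩ := m
      refine ⟨(a, b), Subtype.ext (toC_injective hd ?_)⟩
      change toC d (f (a, b)) = toC d m
      rw [hf, toC, ← h]
      ring
  rw [← (Equiv.ofBijective g hg).tsum_eq, ← tsum_mul_left]
  simp only [← hcoeff]
  rw [e.tsum_eq fun k : ℤ × ℤ => ∫ p : ℝ × ℝ, 𝐞 (-(p.1 * k.1 + p.2 * k.2)) • F p,
    ← tsum_prod_eq_tsum_fourier hFc hF hsum]
  refine tsum_congr fun q => ?_
  simp only [hFdef, ← toC_eq_coordEquiv hd q, ← hf]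
  rfl
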